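/- arXiv:2202.11148 — 4 statements merged into one kernel-verified Lean document; each statement's English description precedes it below -/
import Mathlib

section
/- Let β be an irrational real number and 0 ≤ a < b ≤ 1. Then for every ε > 0 there exists M₀ > 0 such that for every natural number M ≥ M₀ one has card{ m ∈ ℤ : −M ≤ m ≤ M and frac(β·m) ∈ [a,b] } ≤ 2·(b − a + ε)·M. -/
/-- An irrational number has rational approximations `r` with arbitrarily large denominator `q` and
`|x - r| ≤ 1 / q ^ 2`. -/
theorem Irrational.exists_rat_lt_den_abs_sub_le {x : ℝ} (hx : Irrational x) (K : ℕ) :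
    ∃ r : ℚ, K < r.den ∧ |x - r| ≤ 1 / (r.den : ℝ) ^ 2 := by
  have hev := (hx.eventually_forall_le_dist_cast_rat_of_den_le K).filter_mono
    (nhdsWithin_le_nhds (s := Set.Ioi 0))
  obtain ⟨δ, hδ, hδ0⟩ := (hev.and self_mem_nhdsWithin).exists
  have hδ0 : 0 < δ := hδ0
  obtain ⟨n, hn⟩ := exists_nat_one_div_lt hδ0
  obtain ⟨r, hr, hrn⟩ := Real.exists_rat_abs_sub_le_and_den_le x n.succ_pos
  have hd : (1 : ℝ) ≤ r.den := by exact_mod_cast r.den_pos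
  have hdn : (r.den : ℝ) ≤ n + 1 := by exact_mod_cast hrn
  refine ⟨r, ?_, hr.trans ?_⟩
  · by_contra! h
    have h1 := hδ r h
    rw [Real.dist_eq] at h1
    have h2 : 1 / (((n.succ : ℕ) + 1 : ℝ) * r.den) ≤ 1 / ((n : ℝ) + 1) := by
      apply one_div_le_one_div_of_le (by positivity)
      push_cast
      nlinarith
    linarith
  · apply one_div_le_one_div_of_le (by positivity)
    push_cast
    nlinarith

/-- The number of integers in the real interval `[u, v]` is at most `v - u + 1`. -/
theorem Int.card_Icc_ceil_floor_le {u v : ℝ} (h : u ≤ v) :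
    ((Finset.Icc ⌈u⌉ ⌊v⌋).card : ℝ) ≤ v - u + 1 := by
  rw [Int.card_Icc]
  rcases le_total 0 (⌊v⌋ + 1 - ⌈u⌉) with h0 | h0
  · have h1 : (((⌊v⌋ + 1 - ⌈u⌉).toNat : ℤ) : ℝ) = ((⌊v⌋ + 1 - ⌈u⌉ : ℤ) : ℝ) := by
      rw [Int.toNat_of_nonneg h0]
    rw [Int.cast_natCast] at h1
    rw [h1]
    push_cast
    linarith [Int.floor_le v, Int.le_ceil u]
  · rw [Int.toNat_of_nonpos h0]
    push_cast
    linarith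

/-- Among integers from a block of `q` consecutive ones, where `q` is the denominator of a good
rational approximation of `β`, at most `q * (b - a) + 3` satisfy `Int.fract (β * m) ∈ [a, b]`. -/
theorem card_le_of_fract_mul_mem_Icc {β a b : ℝ} (hab : a ≤ b) {r : ℚ}
    (hr : |β - r| ≤ 1 / (r.den : ℝ) ^ 2) (c : ℤ) (s : Finset ℤ)
    (hs : ∀ m ∈ s, c ≤ m ∧ m < c + r.den ∧ Int.fract (β * m) ∈ Set.Icc a b) :
    (s.card : ℝ) ≤ r.den * (b - a) + 3 := by
  have hq : (0 : ℝ) < r.den := by exact_mod_cast r.den_pos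
  have hrq : (r : ℝ) * r.den = r.num := by exact_mod_cast r.mul_den_eq_num
  have hcard : s.card ≤ (Finset.Icc ⌈r.den * a - r.den * (β * c) - 1⌉
      ⌊r.den * b - r.den * (β * c) + 1⌋).card := by
    refine Finset.card_le_card_of_injOn (fun m => r.num * (m - c) - r.den * ⌊β * m⌋) ?_ ?_
    · intro m hm
      obtain ⟨h1, h2, h3, h4⟩ := hs m hm
      have h1' : (c : ℝ) ≤ m := by exact_mod_cast h1
      have h2' : (m : ℝ) < c + r.den := by exact_mod_cast h2
      have herr : |r.den * (m - c) * (β - r)| ≤ 1 := by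
        rw [abs_mul, abs_of_nonneg (mul_nonneg hq.le (sub_nonneg.2 h1'))]
        calc (r.den : ℝ) * (m - c) * |β - r| ≤ r.den * r.den * (1 / (r.den : ℝ) ^ 2) := by
              gcongr; linarith
          _ = 1 := by field_simp
      have hval : ((r.num * (m - c) - r.den * ⌊β * m⌋ : ℤ) : ℝ) =
          r.den * Int.fract (β * m) - r.den * (β * c) - r.den * (m - c) * (β - r) := by
        rw [Int.fract]
        push_cast
        rw [← hrq]
        ring
      have ha := mul_le_mul_of_nonneg_left h3 hq.le
      have hb := mul_le_mul_of_nonneg_left h4 hq.le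
      obtain ⟨he1, he2⟩ := abs_le.1 herr
      simp only [Finset.coe_Icc, Set.mem_Icc]
      rw [Int.ceil_le, Int.le_floor, hval]
      constructor <;> linarith
    · intro m hm n hn hmn
      obtain ⟨h1, h2, -⟩ := hs m hm
      obtain ⟨h3, h4, -⟩ := hs n hn
      have hdvd : (r.den : ℤ) ∣ r.num * (m - n) :=
        ⟨⌊β * m⌋ - ⌊β * n⌋, by simp only at hmn; linarith⟩
      have hcop : IsCoprime (r.den : ℤ) r.num := by
        rw [Int.isCoprime_iff_gcd_eq_one, Int.gcd_comm]
        exact r.reduced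
      have habs : |m - n| < r.den := abs_lt.2 ⟨by linarith, by linarith⟩
      exact sub_eq_zero.1 (Int.eq_zero_of_abs_lt_dvd (hcop.dvd_of_dvd_mul_left hdvd) habs)
  have hlen := mul_le_mul_of_nonneg_left hab hq.le
  calc (s.card : ℝ) ≤ _ := by exact_mod_cast hcard
    _ ≤ _ := Int.card_Icc_ceil_floor_le (by linarith)
    _ = r.den * (b - a) + 3 := by ring

open scoped Classical in
theorem stmt6 (β : ℝ) (hβ : Irrational β) (a b : ℝ)
    (ha : 0 ≤ a) (hab : a < b) (hb : b ≤ 1) :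
    ∀ ε > (0:ℝ), ∃ M₀ > (0:ℝ), ∀ M : ℕ, M₀ ≤ (M : ℝ) →
      (((Finset.Icc (-(M : ℤ)) (M : ℤ)).filter
          (fun m => Int.fract (β * (m : ℝ)) ∈ Set.Icc a b)).card : ℝ) ≤
        2 * (b - a + ε) * M := by
  intro ε hε
  obtain ⟨K, hK⟩ := exists_nat_ge (6 / ε)
  obtain ⟨r, hKr, hr⟩ := hβ.exists_rat_lt_den_abs_sub_le K
  have hq : (0 : ℝ) < r.den := by exact_mod_cast r.den_pos
  have hqZ : (0 : ℤ) < r.den := by exact_mod_cast r.den_pos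
  refine ⟨(r.den + 3) / ε, by positivity, fun M hM => ?_⟩
  set s := (Finset.Icc (-(M : ℤ)) (M : ℤ)).filter
    (fun m : ℤ => Int.fract (β * (m : ℝ)) ∈ Set.Icc a b) with hs
  -- The set in the goal is a set of real numbers: the image of `s` under the coercion `ℤ → ℝ`.
  refine (Nat.cast_le.2 ((Finset.card_le_card (t := s.image ((↑) : ℤ → ℝ)) ?_).trans
    Finset.card_image_le)).trans ?_
  · intro x hx
    simp only [Finset.mem_filter, Finset.bind_def, Finset.pure_def, Finset.mem_sup,
      Finset.mem_singleton] at hx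
    obtain ⟨⟨m, hm, rfl⟩, hfract⟩ := hx
    exact Finset.mem_image_of_mem _ (Finset.mem_filter.2 ⟨hm, hfract⟩)
  have hmaps : ∀ m ∈ s, (m + M) / (r.den : ℤ) ∈ Finset.Icc (0 : ℤ) (2 * M / r.den) := by
    intro m hm
    rw [hs, Finset.mem_filter, Finset.mem_Icc] at hm
    rw [Finset.mem_Icc]
    exact ⟨Int.ediv_nonneg (by linarith) hqZ.le, Int.ediv_le_ediv hqZ (by linarith)⟩
  have hfiber : ∀ t ∈ Finset.Icc (0 : ℤ) (2 * M / r.den),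
      ((s.filter (fun m => (m + M) / (r.den : ℤ) = t)).card : ℝ) ≤ r.den * (b - a) + 3 := by
    intro t _
    refine card_le_of_fract_mul_mem_Icc hab.le hr (t * r.den - M) _ fun m hm => ?_
    rw [Finset.mem_filter, hs, Finset.mem_filter] at hm
    obtain ⟨⟨-, hfract⟩, ht⟩ := hm
    have h1 := Int.ediv_mul_le (m + M) hqZ.ne'
    have h2 := Int.lt_ediv_add_one_mul_self (m + M) hqZ
    rw [ht] at h1 h2
    exact ⟨by linarith, by linarith, hfract⟩
  have hblocks : ((Finset.Icc (0 : ℤ) (2 * M / r.den)).card : ℝ) ≤ 2 * M / r.den + 1 := by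
    have h := Int.card_Icc_ceil_floor_le (u := 0) (v := 2 * M / r.den) (by positivity)
    have hfloor : ⌊(2 * M / r.den : ℝ)⌋ = 2 * (M : ℤ) / r.den := by
      rw [Int.floor_div_natCast]
      exact_mod_cast congrArg (· / (r.den : ℤ)) (Int.floor_natCast (R := ℝ) (2 * M))
    rwa [Int.ceil_zero, hfloor, sub_zero] at h
  have hL : 0 ≤ r.den * (b - a) + 3 := by nlinarith
  have hsum : (s.card : ℝ) ≤ (2 * M / r.den + 1) * (r.den * (b - a) + 3) := by
    rw [Finset.card_eq_sum_card_fiberwise hmaps, Nat.cast_sum]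
    refine (Finset.sum_le_card_nsmul _ _ _ hfiber).trans ?_
    rw [nsmul_eq_mul]
    gcongr
  have hKr' : (K : ℝ) < r.den := by exact_mod_cast hKr
  have h6 : 6 / (r.den : ℝ) ≤ ε := by
    rw [div_le_comm₀ hq hε]
    linarith
  have h6M := mul_le_mul_of_nonneg_right h6 (Nat.cast_nonneg (α := ℝ) M)
  rw [div_le_iff₀ hε] at hM
  have hexp : (2 * M / r.den + 1) * (r.den * (b - a) + 3) =
      2 * M * (b - a) + 6 / (r.den : ℝ) * M + r.den * (b - a) + 3 := by
    field_simp
    ring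
  have hq1 : (r.den : ℝ) * (b - a) ≤ r.den := mul_le_of_le_one_right hq.le (by linarith)
  linarith
end

section
/- Let {y_n}_{n∈ℤ} be a sequence of real numbers with y_n ∈ [0,1) for all n, and suppose the set of limit points of the sequence {sin(2π·y_n)}_{n∈ℤ} has exactly m elements (m a positive integer). Then the set of limit points of {y_n}_{n∈ℤ} has at most 2m + 1 elements. -/
open Filter Topology

/-- The set of limit points of a sequence indexed by `ℤ`: points that are limits of the
sequence along a sequence of pairwise distinct indices. -/
def limitPoints {α : Type*} [TopologicalSpace α] (z : ℤ → α) : Set α :=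
  {w | ∃ φ : ℕ → ℤ, Function.Injective φ ∧
    Tendsto (fun k => z (φ k)) atTop (𝓝 w)}

theorem map_mem_limitPoints {α β : Type*} [TopologicalSpace α] [TopologicalSpace β]
    {f : α → β} (hf : Continuous f) {z : ℤ → α} {w : α} (hw : w ∈ limitPoints z) :
    f w ∈ limitPoints (fun n => f (z n)) := by
  obtain ⟨φ, hφ, h⟩ := hw
  exact ⟨φ, hφ, (hf.tendsto w).comp h⟩

theorem limitPoints_subset_of_isClosed {α : Type*} [TopologicalSpace α] {s : Set α}
    (hs : IsClosed s) {z : ℤ → α} (hz : ∀ n, z n ∈ s) : limitPoints z ⊆ s := by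
  rintro w ⟨φ, -, h⟩
  exact hs.mem_of_tendsto h (Eventually.of_forall fun k => hz (φ k))

/-- A point of `[0, 1)` is one of two explicit functions of `sin (2 * π * x)`. -/
theorem eq_fract_arcsin_or_eq_fract_half_sub_arcsin {x : ℝ} (hx : x ∈ Set.Ico (0 : ℝ) 1) :
    x = Int.fract (Real.arcsin (Real.sin (2 * Real.pi * x)) / (2 * Real.pi)) ∨
    x = Int.fract (1 / 2 - Real.arcsin (Real.sin (2 * Real.pi * x)) / (2 * Real.pi)) := by
  have hsin := Real.sin_arcsin (Real.neg_one_le_sin (2 * Real.pi * x)) (Real.sin_le_one _)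
  set a := Real.arcsin (Real.sin (2 * Real.pi * x))
  have hpi := Real.pi_ne_zero
  obtain ⟨k, h | h⟩ := Real.sin_eq_sin_iff.1 hsin
  · left
    refine (Int.fract_eq_iff.2 ⟨hx.1, hx.2, -k, ?_⟩).symm
    have hxa : x = k + a / (2 * Real.pi) := by
      field_simp
      linarith
    rw [hxa]
    push_cast
    ring
  · right
    refine (Int.fract_eq_iff.2 ⟨hx.1, hx.2, -k, ?_⟩).symm
    have hxa : x = k + (1 / 2 - a / (2 * Real.pi)) := by
      field_simp
      linarith
    rw [hxa]
    push_cast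
    ring

theorem stmt9 (y : ℤ → ℝ) (hy : ∀ n, y n ∈ Set.Ico (0:ℝ) 1)
    (m : ℕ) (hm : 0 < m)
    (hfin : (limitPoints (fun n => Real.sin (2 * Real.pi * y n))).Finite)
    (hcard : (limitPoints (fun n => Real.sin (2 * Real.pi * y n))).ncard = m) :
    (limitPoints y).Finite ∧ (limitPoints y).ncard ≤ 2 * m + 1 := by
  set S := limitPoints (fun n => Real.sin (2 * Real.pi * y n))
  let g : ℝ → ℝ := fun s => Int.fract (Real.arcsin s / (2 * Real.pi))
  let h : ℝ → ℝ := fun s => Int.fract (1 / 2 - Real.arcsin s / (2 * Real.pi))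
  have hsub : limitPoints y ⊆ insert 1 (g '' S ∪ h '' S) := by
    intro x hx
    have hS : Real.sin (2 * Real.pi * x) ∈ S :=
      map_mem_limitPoints (f := fun t => Real.sin (2 * Real.pi * t)) (by fun_prop) hx
    have hx01 : x ∈ Set.Icc (0 : ℝ) 1 :=
      limitPoints_subset_of_isClosed isClosed_Icc (fun n => Set.Ico_subset_Icc_self (hy n)) hx
    rcases hx01.2.eq_or_lt with h1 | h1
    · exact Or.inl h1
    rcases eq_fract_arcsin_or_eq_fract_half_sub_arcsin ⟨hx01.1, h1⟩ with hxs | hxs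
    · exact Or.inr (Or.inl ⟨_, hS, hxs.symm⟩)
    · exact Or.inr (Or.inr ⟨_, hS, hxs.symm⟩)
  have hcover : (insert 1 (g '' S ∪ h '' S)).Finite :=
    ((hfin.image g).union (hfin.image h)).insert 1
  refine ⟨hcover.subset hsub, ?_⟩
  have h1 := Set.ncard_le_ncard hsub hcover
  have h2 := Set.ncard_insert_le 1 (g '' S ∪ h '' S)
  have h3 := Set.ncard_union_le (g '' S) (h '' S)
  have h4 := Set.ncard_image_le (f := g) hfin
  have h5 := Set.ncard_image_le (f := h) hfin
  omega
end

section
/- Let a, b be real numbers and {x_n}_{n∈ℤ} a bounded sequence of real numbers whose set of limit points has exactly m elements (m a positive integer). Then the set of limit points of the sequence {frac(a·x_n + b)}_{n∈ℤ} has at most m + 1 elements. -/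
open Filter Topology

/-- If `y → q` and `Int.fract ∘ y → w`, then `w` is `1` or the fractional part of `q`. -/
theorem eq_one_or_eq_fract_of_tendsto {y : ℕ → ℝ} {q w : ℝ}
    (hy : Tendsto y atTop (𝓝 q))
    (hw : Tendsto (fun k => Int.fract (y k)) atTop (𝓝 w)) :
    w = 1 ∨ w = Int.fract q := by
  have hw0 : 0 ≤ w := ge_of_tendsto' hw fun k => Int.fract_nonneg _
  have hw1 : w ≤ 1 := le_of_tendsto' hw fun k => (Int.fract_lt_one _).le
  have hfloor : Tendsto (fun k => y k - Int.fract (y k)) atTop (𝓝 (q - w)) := hy.sub hw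
  obtain ⟨n, hn⟩ : q - w ∈ Set.range ((↑) : ℤ → ℝ) :=
    Int.isClosedEmbedding_coe_real.isClosed_range.mem_of_tendsto hfloor
      (Eventually.of_forall fun k => ⟨⌊y k⌋, (Int.self_sub_fract _).symm⟩)
  rcases hw1.eq_or_lt with h | h
  · exact Or.inl h
  · exact Or.inr (Int.fract_eq_iff.2 ⟨hw0, h, n, hn.symm⟩).symm

/-- Limit points of the fractional parts of an affine image of a bounded sequence. -/
theorem limitPoints_fract_subset (a b : ℝ) (x : ℤ → ℝ) (C : ℝ) (hC : ∀ n, |x n| ≤ C) :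
    limitPoints (fun n => Int.fract (a * x n + b)) ⊆
      insert 1 ((fun p => Int.fract (a * p + b)) '' limitPoints x) := by
  rintro w ⟨φ, hφ, hw⟩
  obtain ⟨p, -, ψ, hψ, hp⟩ := (isCompact_Icc (a := -C) (b := C)).tendsto_subseq
    (x := fun k => x (φ k)) fun k => abs_le.1 (hC (φ k))
  have hy : Tendsto (fun k => a * x (φ (ψ k)) + b) atTop (𝓝 (a * p + b)) :=
    (hp.const_mul a).add_const b
  rcases eq_one_or_eq_fract_of_tendsto hy (hw.comp hψ.tendsto_atTop) with h | h
  · exact Or.inl h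
  · exact Or.inr ⟨p, ⟨φ ∘ ψ, hφ.comp hψ.injective, hp⟩, h.symm⟩

theorem stmt10 (a b : ℝ) (x : ℤ → ℝ) (C : ℝ) (hC : ∀ n, |x n| ≤ C)
    (m : ℕ) (hm : 0 < m)
    (hfin : (limitPoints x).Finite) (hcard : (limitPoints x).ncard = m) :
    (limitPoints (fun n => Int.fract (a * x n + b))).Finite ∧
    (limitPoints (fun n => Int.fract (a * x n + b))).ncard ≤ m + 1 := by
  have hsub := limitPoints_fract_subset a b x C hC
  have himage := hfin.image fun p => Int.fract (a * p + b)
  refine ⟨(himage.insert 1).subset hsub, (Set.ncard_le_ncard hsub (himage.insert 1)).trans ?_⟩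
  refine (Set.ncard_insert_le _ _).trans ?_
  rw [← hcard]
  exact Nat.add_le_add_right (Set.ncard_image_le hfin) 1
end

section
/- Let b₁, b₂ be nonzero real numbers with b₂/b₁ irrational. Let {α_n}_{n∈ℤ} be an incompressible sequence of real numbers (i.e. there exists d ∈ ℕ such that card{n ∈ ℤ : |α_n − t| ≤ 1} ≤ d for every t ∈ ℝ), and suppose there exist γ > 0 and M₀ > 0 such that card{n ∈ ℤ : |α_n| ≤ M} ≥ γ·M for all M ≥ M₀. Then at least one of the two sequences {sin(b₁·α_n)}_{n∈ℤ} and {sin(b₂·α_n)}_{n∈ℤ} has an infinite set of limit points. -/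
open Filter Topology

open Complex in
/-- The point of the unit circle with angle `x`. -/
noncomputable def circlePoint (x : ℝ) : ℂ := exp (x * I)

lemma norm_circlePoint (x : ℝ) : ‖circlePoint x‖ = 1 :=
  Complex.norm_exp_ofReal_mul_I x

lemma circlePoint_im (x : ℝ) : (circlePoint x).im = Real.sin x :=
  Complex.exp_ofReal_mul_I_im x

lemma continuous_circlePoint : Continuous circlePoint := by
  unfold circlePoint
  fun_prop

lemma dist_circlePoint (x y : ℝ) :
    dist (circlePoint x) (circlePoint y) = dist (circlePoint (x - y)) 1 := by
  have h : circlePoint x = circlePoint (x - y) * circlePoint y := by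
    simp only [circlePoint, ← Complex.exp_add]
    congr 1
    push_cast
    ring
  rw [dist_eq_norm, dist_eq_norm]
  calc ‖circlePoint x - circlePoint y‖
      = ‖(circlePoint (x - y) - 1) * circlePoint y‖ := by rw [h]; congr 1; ring
    _ = ‖circlePoint (x - y) - 1‖ := by rw [norm_mul, norm_circlePoint, mul_one]

lemma exists_int_of_circlePoint_eq_one {x : ℝ} (h : circlePoint x = 1) :
    ∃ k : ℤ, x = k * (2 * Real.pi) := by
  obtain ⟨k, hk⟩ := Complex.exp_eq_one_iff.1 h
  refine ⟨k, ?_⟩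
  have := congrArg Complex.im hk
  simpa using this

lemma eq_zero_of_circlePoint_eq_one {b₁ b₂ t : ℝ}
    (hirr : Irrational (b₂ / b₁)) (h₁ : circlePoint (b₁ * t) = 1)
    (h₂ : circlePoint (b₂ * t) = 1) : t = 0 := by
  by_contra ht
  obtain ⟨k, hk⟩ := exists_int_of_circlePoint_eq_one h₁
  obtain ⟨l, hl⟩ := exists_int_of_circlePoint_eq_one h₂
  refine hirr ⟨(l : ℚ) / k, ?_⟩
  push_cast
  calc (l : ℝ) / k = (l * (2 * Real.pi)) / (k * (2 * Real.pi)) :=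
        (mul_div_mul_right _ _ (by positivity)).symm
    _ = (b₂ * t) / (b₁ * t) := by rw [hk, hl]
    _ = b₂ / b₁ := mul_div_mul_right _ _ ht

/-- Common approximate periods of two incommensurable rotations are sparse. -/
lemma exists_pos_forall_abs_le_one {b₁ b₂ : ℝ}
    (hirr : Irrational (b₂ / b₁)) (R : ℝ) :
    ∃ ε > 0, ∀ t : ℝ, |t| ≤ R → dist (circlePoint (b₁ * t)) 1 < ε →
      dist (circlePoint (b₂ * t)) 1 < ε → |t| ≤ 1 := by
  let f : ℝ → ℝ := fun t =>
    max (dist (circlePoint (b₁ * t)) 1) (dist (circlePoint (b₂ * t)) 1)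
  have hf : Continuous f := by
    have := continuous_circlePoint
    fun_prop
  have hK : IsCompact (Set.Icc (-R) R ∩ {t : ℝ | 1 ≤ |t|}) :=
    isCompact_Icc.inter_right (isClosed_le continuous_const continuous_abs)
  have hpos : ∀ t ∈ Set.Icc (-R) R ∩ {t : ℝ | 1 ≤ |t|}, 0 < f t := by
    intro t ht
    by_contra! h
    have h₁ := dist_le_zero.1 ((le_max_left _ _).trans h)
    have h₂ := dist_le_zero.1 ((le_max_right _ _).trans h)
    have h0 := eq_zero_of_circlePoint_eq_one hirr h₁ h₂
    have := ht.2
    norm_num [h0] at this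
  obtain ⟨ε, hε, h⟩ := hK.exists_forall_le' hf.continuousOn hpos
  refine ⟨ε, hε, fun t htR h₁ h₂ => ?_⟩
  by_contra! ht
  exact absurd (max_lt h₁ h₂) (not_lt.2 (h t ⟨abs_le.1 htR, ht.le⟩))

/-- A sequence in a compact set all of whose limit points lie in `K` is eventually close to `K`. -/
lemma finite_setOf_forall_le_dist {X : Type*} [PseudoMetricSpace X] {C K : Set X}
    (hC : IsCompact C) {u : ℤ → X} (hu : ∀ n, u n ∈ C) (hK : limitPoints u ⊆ K)
    {ε : ℝ} (hε : 0 < ε) : {n : ℤ | ∀ w ∈ K, ε ≤ dist (u n) w}.Finite := by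
  by_contra hinf
  have hinf : {n : ℤ | ∀ w ∈ K, ε ≤ dist (u n) w}.Infinite := hinf
  let φ := hinf.natEmbedding
  obtain ⟨w, -, ψ, hψ, hlim⟩ := hC.tendsto_subseq (x := fun k => u (φ k)) fun k => hu _
  have hwK : w ∈ K := hK ⟨fun k => φ (ψ k),
    Subtype.val_injective.comp (φ.injective.comp hψ.injective), hlim⟩
  obtain ⟨k, hk⟩ := (hlim.eventually (Metric.ball_mem_nhds w hε)).exists
  exact absurd hk (not_lt.2 ((φ (ψ k)).2 w hwK))

lemma finite_setOf_norm_eq_one_im_mem {L : Set ℝ} (hL : L.Finite) :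
    {w : ℂ | ‖w‖ = 1 ∧ w.im ∈ L}.Finite := by
  refine ((hL.image fun y => (⟨√(1 - y ^ 2), y⟩ : ℂ)).union
    (hL.image fun y => (⟨-√(1 - y ^ 2), y⟩ : ℂ))).subset ?_
  rintro w ⟨hw, hL⟩
  have h : w.re ^ 2 = 1 - w.im ^ 2 := by
    have := Complex.sq_norm w
    rw [hw, Complex.normSq_apply] at this
    linarith
  rcases le_total 0 w.re with h0 | h0
  · exact Or.inl ⟨w.im, hL, Complex.ext (by simp [← h, Real.sqrt_sq h0]) rfl⟩
  · exact Or.inr ⟨w.im, hL, Complex.ext (by simp [← h, Real.sqrt_sq_eq_abs, abs_of_nonpos h0]) rfl⟩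

lemma limitPoints_circlePoint_subset (x y : ℤ → ℝ) :
    limitPoints (fun n => (circlePoint (x n), circlePoint (y n))) ⊆
      {w : ℂ | ‖w‖ = 1 ∧ w.im ∈ limitPoints fun n => Real.sin (x n)} ×ˢ
        {w : ℂ | ‖w‖ = 1 ∧ w.im ∈ limitPoints fun n => Real.sin (y n)} := by
  have key : ∀ (z : ℤ → ℝ) (φ : ℕ → ℤ) (w : ℂ), Function.Injective φ →
      Tendsto (fun k => circlePoint (z (φ k))) atTop (𝓝 w) →
      ‖w‖ = 1 ∧ w.im ∈ limitPoints fun n => Real.sin (z n) := by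
    intro z φ w hφ h
    refine ⟨tendsto_nhds_unique h.norm (by simp [norm_circlePoint]), φ, hφ, ?_⟩
    simpa only [circlePoint_im, Function.comp_def] using
      (Complex.continuous_im.tendsto w).comp h
  rintro w ⟨φ, hφ, h⟩
  exact ⟨key x φ w.1 hφ ((continuous_fst.tendsto w).comp h),
    key y φ w.2 hφ ((continuous_snd.tendsto w).comp h)⟩

lemma floor_div_mem_Icc {R x : ℝ} (hR : 0 < R) {N : ℕ} (hx : |x| ≤ N * R) :
    ⌊x / R⌋ ∈ Finset.Icc (-N : ℤ) N := by
  obtain ⟨h₁, h₂⟩ := abs_le.1 hx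
  rw [Finset.mem_Icc]
  constructor
  · rw [Int.le_floor, le_div_iff₀ hR]
    push_cast
    linarith
  · have : (⌊x / R⌋ : ℝ) ≤ N := (Int.floor_le _).trans ((div_le_iff₀ hR).2 h₂)
    exact_mod_cast this

lemma abs_sub_le_of_floor_div_eq {R x y : ℝ} (hR : 0 < R) (h : ⌊x / R⌋ = ⌊y / R⌋) :
    |x - y| ≤ R := by
  have := (Int.abs_sub_lt_one_of_floor_eq_floor h).le
  rwa [← sub_div, abs_div, abs_of_pos hR, div_le_one hR] at this

/-- If the points of each colour within distance `R` of each other are within distance `1`, then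
an incompressible sequence has few coloured points in `[-N R, N R]`. -/
lemma card_le_of_coloring {ι : Type*} {al : ℤ → ℝ} {d : ℕ}
    (hd : ∀ t : ℝ, {n : ℤ | |al n - t| ≤ 1}.Finite ∧ {n : ℤ | |al n - t| ≤ 1}.ncard ≤ d)
    {R : ℝ} (hR : 0 < R) (K : Finset ι) (c : ℤ → ι) (N : ℕ) (S : Finset ℤ)
    (hS : ∀ n ∈ S, |al n| ≤ N * R) (hc : ∀ n ∈ S, c n ∈ K)
    (hsep : ∀ n ∈ S, ∀ m ∈ S, c n = c m → |al n - al m| ≤ R → |al n - al m| ≤ 1) :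
    S.card ≤ d * ((2 * N + 1) * K.card) := by
  classical
  have h := Finset.card_le_mul_card_image_of_maps_to (s := S)
    (t := Finset.Icc (-N : ℤ) N ×ˢ K) (f := fun n => (⌊al n / R⌋, c n))
    (fun n hn => Finset.mem_product.2 ⟨floor_div_mem_Icc hR (hS n hn), hc n hn⟩) d ?_
  · rw [Finset.card_product, Int.card_Icc] at h
    convert h using 3
    lia
  · intro p _
    rcases (S.filter fun n => (⌊al n / R⌋, c n) = p).eq_empty_or_nonempty with h0 | ⟨m, hm⟩
    · simp [h0]
    · obtain ⟨hmS, hmp⟩ := Finset.mem_filter.1 hm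
      rw [← Set.ncard_coe_finset]
      refine (Set.ncard_le_ncard ?_ (hd (al m)).1).trans (hd (al m)).2
      intro n hn
      obtain ⟨hnS, hnp⟩ := Finset.mem_filter.1 (Finset.mem_coe.1 hn)
      obtain ⟨hfl, hcol⟩ := Prod.ext_iff.1 (hnp.trans hmp.symm)
      exact hsep n hnS m hmS hcol (abs_sub_le_of_floor_div_eq hR hfl)

theorem stmt11 (b₁ b₂ : ℝ) (hb₁ : b₁ ≠ 0) (hb₂ : b₂ ≠ 0)
    (hirr : Irrational (b₂ / b₁))
    (al : ℤ → ℝ)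
    -- incompressibility
    (hinc : ∃ d : ℕ, ∀ t : ℝ, {n : ℤ | |al n - t| ≤ 1}.Finite ∧
      {n : ℤ | |al n - t| ≤ 1}.ncard ≤ d)
    -- lower density bound
    (γ M₀ : ℝ) (hγ : 0 < γ) (hM₀ : 0 < M₀)
    (hcard : ∀ M : ℝ, M₀ ≤ M → ∃ S : Finset ℤ,
      (↑S : Set ℤ) ⊆ {n : ℤ | |al n| ≤ M} ∧ γ * M ≤ (S.card : ℝ)) :
    (limitPoints (fun n => Real.sin (b₁ * al n))).Infinite ∨
    (limitPoints (fun n => Real.sin (b₂ * al n))).Infinite := by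
  classical
  by_contra hfin
  obtain ⟨hL₁, hL₂⟩ := not_or.1 hfin
  rw [Set.not_infinite] at hL₁ hL₂
  obtain ⟨d, hd⟩ := hinc
  let u : ℤ → ℂ × ℂ := fun n => (circlePoint (b₁ * al n), circlePoint (b₂ * al n))
  obtain ⟨K, hK⟩ := ((finite_setOf_norm_eq_one_im_mem hL₁).prod
    (finite_setOf_norm_eq_one_im_mem hL₂)).exists_finset_coe
  have hlim : limitPoints u ⊆ K := hK ▸ limitPoints_circlePoint_subset _ _
  have hu : ∀ n, u n ∈ Metric.sphere (0 : ℂ) 1 ×ˢ Metric.sphere (0 : ℂ) 1 := fun n => by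
    simp [u, norm_circlePoint]
  obtain ⟨R, hR⟩ : ∃ R : ℝ, R = (2 * d * K.card + 1) / γ := ⟨_, rfl⟩
  have hRpos : 0 < R := by rw [hR]; positivity
  obtain ⟨ε, hε, hsep⟩ := exists_pos_forall_abs_le_one hirr R
  obtain ⟨E, hE⟩ := (finite_setOf_forall_le_dist
    ((isCompact_sphere _ _).prod (isCompact_sphere _ _)) hu hlim
    (half_pos hε)).exists_finset_coe
  have hcol : ∀ n, ∃ w, n ∉ E → w ∈ K ∧ dist (u n) w < ε / 2 := by
    intro n
    by_cases hn : n ∈ E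
    · exact ⟨0, fun h => absurd hn h⟩
    · rw [← Finset.mem_coe, hE] at hn
      simp only [Set.mem_ofPred_eq, not_forall, not_le] at hn
      obtain ⟨w, hw, hlt⟩ := hn
      exact ⟨w, fun _ => ⟨hw, hlt⟩⟩
  choose c hc using hcol
  obtain ⟨N, hN⟩ := exists_nat_gt (max (M₀ / R) (E.card + d * K.card))
  obtain ⟨hN₁, hN₂⟩ := max_lt_iff.1 hN
  obtain ⟨S, hS, hcardS⟩ := hcard (N * R) ((div_lt_iff₀ hRpos).1 hN₁).le
  have hcount := card_le_of_coloring hd hRpos K c N (S \ E)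
    (fun n hn => hS (Finset.mem_sdiff.1 hn).1) (fun n hn => (hc n (Finset.mem_sdiff.1 hn).2).1)
    (fun n hn m hm hnm hle => by
      have hn' := (hc n (Finset.mem_sdiff.1 hn).2).2
      have hm' := (hc m (Finset.mem_sdiff.1 hm).2).2
      rw [hnm] at hn'
      have hlt : dist (u n) (u m) < ε := by
        linarith [dist_triangle_right (u n) (u m) (c m)]
      obtain ⟨h₁, h₂⟩ := max_lt_iff.1 (Prod.dist_eq (x := u n) ▸ hlt)
      refine hsep _ hle ?_ ?_
      · rwa [mul_sub, ← dist_circlePoint]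
      · rwa [mul_sub, ← dist_circlePoint])
  have hSE : (S.card : ℝ) ≤ d * ((2 * N + 1) * K.card) + E.card := by
    exact_mod_cast (Finset.card_le_card_sdiff_add_card (s := S) (t := E)).trans
      (Nat.add_le_add_right hcount _)
  have hγR : γ * (N * R) = N * (2 * d * K.card + 1) := by
    rw [hR]
    field_simp
  nlinarith
end
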